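/- arXiv:2309.03521 — 10 statements merged into one kernel-verified Lean document; each statement's English description precedes it below -/
import Mathlib

section
/- Suppose g is integrable on [0,∞) and the hazard rate satisfies λ(x) > c_p/c_cs for every x ≥ 0. Then g(x) < 0 for every x ≥ 0, and for every measurable set S ⊆ [0,∞), ∫_{[0,∞)} g(x) dx ≤ ∫_S g(x) dx; that is, the policy whose keep-alive window is always active (S = [0,∞)) minimizes the expected cost c_cs + ∫_S g(x) dx over all measurable policies. -/
open MeasureTheory Set

/-- If the hazard rate always exceeds `c_p / c_cs`, then `g < 0` everywhere on
`[0,∞)` and the always-active policy `S = [0,∞)` minimizes the expected cost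
`c_cs + ∫_S g` over all measurable policies. -/
theorem always_active_optimal
    (c_p c_cs : ℝ) (hcp : 0 < c_p) (hccs : 0 < c_cs)
    (f F lam g : ℝ → ℝ)
    (hf_cont : Continuous f)
    (hf_nonneg : ∀ x, 0 ≤ x → 0 ≤ f x)
    (hf_int : ∫ x in Set.Ioi (0 : ℝ), f x = 1)
    (hF : ∀ x, F x = ∫ t in (0 : ℝ)..x, f t)
    (hFlt : ∀ x, 0 ≤ x → F x < 1)
    (hlam : ∀ x, lam x = f x / (1 - F x))
    (hg : ∀ x, g x = c_p * (1 - F x) - c_cs * f x)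
    (hg_int : IntegrableOn g (Set.Ici 0))
    (hlam_gt : ∀ x, 0 ≤ x → c_p / c_cs < lam x) :
    (∀ x, 0 ≤ x → g x < 0) ∧
    ∀ S : Set ℝ, MeasurableSet S → S ⊆ Set.Ici 0 →
      ∫ x in Set.Ici (0 : ℝ), g x ≤ ∫ x in S, g x := by
  have hg_neg : ∀ x, 0 ≤ x → g x < 0 := by
    intro x hx
    have h := hlam_gt x hx
    rw [hlam, div_lt_div_iff₀ hccs (sub_pos.mpr (hFlt x hx))] at h
    rw [hg]
    linarith
  refine ⟨hg_neg, fun S _ hS => ?_⟩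
  have h : ∫ x in S, -g x ≤ ∫ x in Set.Ici (0 : ℝ), -g x := by
    refine setIntegral_mono_set hg_int.neg ?_ hS.eventuallyLE
    filter_upwards [ae_restrict_mem measurableSet_Ici] with x hx
    exact neg_nonneg.mpr (hg_neg x hx).le
  rwa [integral_neg, integral_neg, neg_le_neg_iff] at h
end

section
/- Suppose the hazard rate λ is weakly decreasing on [0,∞) and λ(0) < c_p/c_cs. Then g(x) > 0 for every x ≥ 0, and consequently for every measurable set S ⊆ [0,∞) with g integrable on S, ∫_S g(x) dx ≥ 0; that is, the empty policy S = ∅ (keep-alive window of length 0, always incurring a cold start, with expected cost c_cs) minimizes the expected cost c_cs + ∫_S g(x) dx over all measurable policies. -/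
open MeasureTheory Set

/-- If the hazard rate is weakly decreasing on `[0,∞)` and `λ 0 < c_p / c_cs`,
then `g > 0` everywhere on `[0,∞)` and the empty policy (always a cold start,
expected cost `c_cs`) minimizes the expected cost `c_cs + ∫_S g`. -/
theorem empty_policy_optimal
    (c_p c_cs : ℝ) (hcp : 0 < c_p) (hccs : 0 < c_cs)
    (f F lam g : ℝ → ℝ)
    (hf_cont : Continuous f)
    (hf_nonneg : ∀ x, 0 ≤ x → 0 ≤ f x)
    (hf_int : ∫ x in Set.Ioi (0 : ℝ), f x = 1)
    (hF : ∀ x, F x = ∫ t in (0 : ℝ)..x, f t)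
    (hFlt : ∀ x, 0 ≤ x → F x < 1)
    (hlam : ∀ x, lam x = f x / (1 - F x))
    (hg : ∀ x, g x = c_p * (1 - F x) - c_cs * f x)
    (hlam_anti : AntitoneOn lam (Set.Ici 0))
    (hlam0 : lam 0 < c_p / c_cs) :
    (∀ x, 0 ≤ x → 0 < g x) ∧
    ∀ S : Set ℝ, MeasurableSet S → S ⊆ Set.Ici 0 → IntegrableOn g S →
      (0 : ℝ) ≤ ∫ x in S, g x := by
  have hpos : ∀ x, 0 ≤ x → 0 < g x := by
    intro x hx
    have hsurv : 0 < 1 - F x := sub_pos.mpr (hFlt x hx)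
    have hlt : lam x < c_p / c_cs :=
      (hlam_anti Set.self_mem_Ici (Set.mem_Ici.mpr hx) hx).trans_lt hlam0
    rw [hlam, div_lt_div_iff₀ hsurv hccs] at hlt
    rw [hg]
    linarith
  exact ⟨hpos, fun S hS hS0 _ => setIntegral_nonneg hS fun x hx => (hpos x (hS0 hx)).le⟩
end

section
/- Suppose g is integrable on [0,∞), the hazard rate λ is weakly decreasing on [0,∞), and τ ≥ 0 satisfies λ(τ) = c_p/c_cs. Then g(x) ≤ 0 for all x ∈ [0,τ] and g(x) ≥ 0 for all x ≥ τ, and consequently for every measurable set S ⊆ [0,∞), ∫_{[0,τ]} g(x) dx ≤ ∫_S g(x) dx; that is, the single keep-alive window [0,τ] starting immediately after the last arrival minimizes the expected cost c_cs + ∫_S g(x) dx over all measurable policies. -/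
open MeasureTheory Set

/-- A measurable set `T` on which `g ≤ 0`, with `0 ≤ g` on the rest of `A`, minimizes the integral
of `g` among the measurable subsets of `A`. -/
theorem setIntegral_le_of_nonpos_of_nonneg_sdiff {α : Type*} [MeasurableSpace α] {μ : Measure α}
    {g : α → ℝ} {A S T : Set α} (hg : IntegrableOn g A μ)
    (hT : MeasurableSet T) (hTA : T ⊆ A) (hS : MeasurableSet S) (hSA : S ⊆ A)
    (hneg : ∀ x ∈ T, g x ≤ 0) (hpos : ∀ x ∈ A \ T, 0 ≤ g x) :
    ∫ x in T, g x ∂μ ≤ ∫ x in S, g x ∂μ := by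
  have hsplitT := integral_inter_add_sdiff hS (hg.mono_set hTA)
  have hsplitS := integral_inter_add_sdiff hT (hg.mono_set hSA)
  have hTS : ∫ x in T \ S, g x ∂μ ≤ 0 :=
    setIntegral_nonpos (hT.diff hS) fun x hx => hneg x hx.1
  have hST : 0 ≤ ∫ x in S \ T, g x ∂μ :=
    setIntegral_nonneg (hS.diff hT) fun x hx => hpos x ⟨hSA hx.1, hx.2⟩
  rw [Set.inter_comm] at hsplitS
  linarith

/-- If the hazard rate is weakly decreasing on `[0,∞)` and `λ τ = c_p / c_cs`,
then `g ≤ 0` on `[0,τ]`, `g ≥ 0` on `[τ,∞)`, and the single keep-alive window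
`[0,τ]` minimizes the expected cost `c_cs + ∫_S g` over all measurable
policies. -/
theorem single_window_optimal_decreasing_hazard
    (c_p c_cs : ℝ) (hcp : 0 < c_p) (hccs : 0 < c_cs)
    (f F lam g : ℝ → ℝ)
    (hf_cont : Continuous f)
    (hf_nonneg : ∀ x, 0 ≤ x → 0 ≤ f x)
    (hf_int : ∫ x in Set.Ioi (0 : ℝ), f x = 1)
    (hF : ∀ x, F x = ∫ t in (0 : ℝ)..x, f t)
    (hFlt : ∀ x, 0 ≤ x → F x < 1)
    (hlam : ∀ x, lam x = f x / (1 - F x))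
    (hg : ∀ x, g x = c_p * (1 - F x) - c_cs * f x)
    (hg_int : IntegrableOn g (Set.Ici 0))
    (hlam_anti : AntitoneOn lam (Set.Ici 0))
    (τ : ℝ) (hτ : 0 ≤ τ) (hτ_eq : lam τ = c_p / c_cs) :
    (∀ x ∈ Set.Icc 0 τ, g x ≤ 0) ∧
    (∀ x, τ ≤ x → 0 ≤ g x) ∧
    ∀ S : Set ℝ, MeasurableSet S → S ⊆ Set.Ici 0 →
      ∫ x in Set.Icc (0 : ℝ) τ, g x ≤ ∫ x in S, g x := by
  have hfactor : ∀ x, 0 ≤ x → g x = c_cs * (1 - F x) * (lam τ - lam x) := by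
    intro x hx
    have h : 1 - F x ≠ 0 := (sub_pos.2 (hFlt x hx)).ne'
    rw [hg, hτ_eq, hlam]
    field_simp
  have hcoef : ∀ x, 0 ≤ x → 0 ≤ c_cs * (1 - F x) := fun x hx =>
    mul_nonneg hccs.le (sub_nonneg.2 (hFlt x hx).le)
  have hneg : ∀ x ∈ Set.Icc 0 τ, g x ≤ 0 := by
    intro x hx
    rw [hfactor x hx.1]
    exact mul_nonpos_of_nonneg_of_nonpos (hcoef x hx.1)
      (sub_nonpos.2 (hlam_anti hx.1 hτ hx.2))
  have hpos : ∀ x, τ ≤ x → 0 ≤ g x := by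
    intro x hx
    have hx0 : 0 ≤ x := hτ.trans hx
    rw [hfactor x hx0]
    exact mul_nonneg (hcoef x hx0) (sub_nonneg.2 (hlam_anti hτ hx0 hx))
  refine ⟨hneg, hpos, fun S hS hSA => ?_⟩
  refine setIntegral_le_of_nonpos_of_nonneg_sdiff hg_int measurableSet_Icc
    Set.Icc_subset_Ici_self hS hSA hneg fun x hx => hpos x ?_
  exact (not_le.1 fun h => hx.2 ⟨hx.1, h⟩).le
end

section
/- Suppose g is integrable on [0,∞), the hazard rate λ is weakly increasing on [0,∞), and τ_pw ≥ 0 satisfies λ(τ_pw) = c_p/c_cs. Then g(x) ≥ 0 for all x ∈ [0, τ_pw] and g(x) ≤ 0 for all x ≥ τ_pw, and consequently for every measurable set S ⊆ [0,∞), ∫_{[τ_pw, ∞)} g(x) dx ≤ ∫_S g(x) dx; that is, a pre-warming window of length τ_pw followed by an infinite keep-alive window (S = [τ_pw, ∞)) minimizes the expected cost c_cs + ∫_S g(x) dx over all measurable policies. -/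
open MeasureTheory Set

/-- The integral of `g` over a set `T ⊆ U` with `g ≤ 0` on `T` and `0 ≤ g` on `U \ T` is minimal
among the integrals of `g` over measurable subsets of `U`. -/
theorem setIntegral_le_of_nonpos_of_nonneg_diff {α : Type*} [MeasurableSpace α] {μ : Measure α}
    {g : α → ℝ} {S T U : Set α} (hS : MeasurableSet S) (hT : MeasurableSet T)
    (hSU : S ⊆ U) (hTU : T ⊆ U) (hg : IntegrableOn g U μ)
    (hneg : ∀ x ∈ T, g x ≤ 0) (hpos : ∀ x ∈ U \ T, 0 ≤ g x) :
    ∫ x in T, g x ∂μ ≤ ∫ x in S, g x ∂μ := by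
  rw [← integral_inter_add_sdiff hS (hg.mono_set hTU),
    ← integral_inter_add_sdiff hT (hg.mono_set hSU), inter_comm T S]
  have hTS : ∫ x in T \ S, g x ∂μ ≤ 0 :=
    setIntegral_nonpos (hT.diff hS) fun x hx => hneg x hx.1
  have hST : 0 ≤ ∫ x in S \ T, g x ∂μ :=
    setIntegral_nonneg (hS.diff hT) fun x hx => hpos x ⟨hSU hx.1, hx.2⟩
  linarith

/-- If the hazard rate is weakly increasing on `[0,∞)` and `λ τ_pw = c_p / c_cs`,
then `g ≥ 0` on `[0,τ_pw]`, `g ≤ 0` on `[τ_pw,∞)`, and pre-warming for `τ_pw`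
followed by an infinite keep-alive window (`S = [τ_pw,∞)`) minimizes the
expected cost `c_cs + ∫_S g` over all measurable policies. -/
theorem prewarming_optimal_increasing_hazard
    (c_p c_cs : ℝ) (hcp : 0 < c_p) (hccs : 0 < c_cs)
    (f F lam g : ℝ → ℝ)
    (hf_cont : Continuous f)
    (hf_nonneg : ∀ x, 0 ≤ x → 0 ≤ f x)
    (hf_int : ∫ x in Set.Ioi (0 : ℝ), f x = 1)
    (hF : ∀ x, F x = ∫ t in (0 : ℝ)..x, f t)
    (hFlt : ∀ x, 0 ≤ x → F x < 1)
    (hlam : ∀ x, lam x = f x / (1 - F x))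
    (hg : ∀ x, g x = c_p * (1 - F x) - c_cs * f x)
    (hg_int : IntegrableOn g (Set.Ici 0))
    (hlam_mono : MonotoneOn lam (Set.Ici 0))
    (τ_pw : ℝ) (hτ : 0 ≤ τ_pw) (hτ_eq : lam τ_pw = c_p / c_cs) :
    (∀ x ∈ Set.Icc 0 τ_pw, 0 ≤ g x) ∧
    (∀ x, τ_pw ≤ x → g x ≤ 0) ∧
    ∀ S : Set ℝ, MeasurableSet S → S ⊆ Set.Ici 0 →
      ∫ x in Set.Ici τ_pw, g x ≤ ∫ x in S, g x := by
  have hpos : ∀ x ∈ Set.Icc 0 τ_pw, 0 ≤ g x := by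
    intro x hx
    have h := hlam_mono (mem_Ici.2 hx.1) (mem_Ici.2 hτ) hx.2
    rw [hτ_eq, hlam, div_le_div_iff₀ (sub_pos.2 (hFlt x hx.1)) hccs] at h
    rw [hg]
    linarith
  have hneg : ∀ x, τ_pw ≤ x → g x ≤ 0 := by
    intro x hx
    have hx0 := hτ.trans hx
    have h := hlam_mono (mem_Ici.2 hτ) (mem_Ici.2 hx0) hx
    rw [hτ_eq, hlam, div_le_div_iff₀ hccs (sub_pos.2 (hFlt x hx0))] at h
    rw [hg]
    linarith
  refine ⟨hpos, hneg, fun S hS hS0 => ?_⟩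
  exact setIntegral_le_of_nonpos_of_nonneg_diff hS measurableSet_Ici hS0 (Ici_subset_Ici.2 hτ)
    hg_int hneg fun x hx => hpos x ⟨hx.1, (not_le.1 hx.2).le⟩
end

section
/- Suppose the hazard rate λ is weakly decreasing on [0,∞). Then g changes sign at most once and only from negative to positive: for all 0 ≤ x₁ ≤ x₂, if g(x₁) > 0 then g(x₂) > 0. -/
open MeasureTheory Set

/-- If the hazard rate is weakly decreasing on `[0,∞)`, then `g` changes sign
at most once, from negative to positive: once `g` is positive it stays
positive. -/
theorem g_single_sign_change
    (c_p c_cs : ℝ) (hcp : 0 < c_p) (hccs : 0 < c_cs)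
    (f F lam g : ℝ → ℝ)
    (hf_cont : Continuous f)
    (hf_nonneg : ∀ x, 0 ≤ x → 0 ≤ f x)
    (hf_int : ∫ x in Set.Ioi (0 : ℝ), f x = 1)
    (hF : ∀ x, F x = ∫ t in (0 : ℝ)..x, f t)
    (hFlt : ∀ x, 0 ≤ x → F x < 1)
    (hlam : ∀ x, lam x = f x / (1 - F x))
    (hg : ∀ x, g x = c_p * (1 - F x) - c_cs * f x)
    (hlam_anti : AntitoneOn lam (Set.Ici 0)) :
    ∀ x₁ x₂ : ℝ, 0 ≤ x₁ → x₁ ≤ x₂ → 0 < g x₁ → 0 < g x₂ := by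
  intro x₁ x₂ h₀ h₁₂ hg₁
  have h₀' : 0 ≤ x₂ := h₀.trans h₁₂
  have hS₁ : 0 < 1 - F x₁ := sub_pos.mpr (hFlt x₁ h₀)
  have hS₂ : 0 < 1 - F x₂ := sub_pos.mpr (hFlt x₂ h₀')
  have g_eq : ∀ x, 0 < 1 - F x → g x = (1 - F x) * (c_p - c_cs * lam x) := by
    intro x hx
    rw [hg, hlam]
    field_simp
  rw [g_eq x₁ hS₁, mul_pos_iff_of_pos_left hS₁] at hg₁
  rw [g_eq x₂ hS₂]
  have hle : c_cs * lam x₂ ≤ c_cs * lam x₁ :=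
    mul_le_mul_of_nonneg_left (hlam_anti h₀ h₀' h₁₂) hccs.le
  exact mul_pos hS₂ (by linarith)
end

section
/- Let the inter-arrival time be exponential with rate μ > 0, i.e., f(x) = μ·e^{−μx} and F(x) = 1 − e^{−μx} for x ≥ 0, so g(x) = c_p·e^{−μx} − c_cs·μ·e^{−μx}. Then: (i) the expected cost of the always-active policy is c_cs + ∫_0^∞ g(x) dx = c_p/μ; (ii) if c_p ≤ c_cs·μ then for every measurable S ⊆ [0,∞), c_cs + ∫_S g(x) dx ≥ c_p/μ, with equality for S = [0,∞); and (iii) if c_p > c_cs·μ then for every measurable S ⊆ [0,∞), c_cs + ∫_S g(x) dx ≥ c_cs, with equality for S = ∅. -/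
open MeasureTheory Set

/-- A function equal to `a * exp (-μ * x)` on `[0,∞)` is integrable there. -/
theorem integrableOn_Ici_of_eq_mul_exp {a μ : ℝ} (hμ : 0 < μ) {g : ℝ → ℝ}
    (hg : ∀ x, 0 ≤ x → g x = a * Real.exp (-μ * x)) : IntegrableOn g (Ici 0) := by
  rw [integrableOn_Ici_iff_integrableOn_Ioi]
  exact IntegrableOn.congr_fun ((integrableOn_exp_mul_Ioi (neg_lt_zero.mpr hμ) 0).const_mul a)
    (fun x hx => (hg x (le_of_lt hx)).symm) measurableSet_Ioi

/-- The integral over `[0,∞)` of a function equal to `a * exp (-μ * x)` there. -/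
theorem integral_Ici_of_eq_mul_exp {a μ : ℝ} (hμ : 0 < μ) {g : ℝ → ℝ}
    (hg : ∀ x, 0 ≤ x → g x = a * Real.exp (-μ * x)) : ∫ x in Ici (0 : ℝ), g x = a / μ := by
  rw [integral_Ici_eq_integral_Ioi,
    setIntegral_congr_fun measurableSet_Ioi (fun x hx => hg x (le_of_lt hx)),
    integral_const_mul, integral_exp_mul_Ioi (neg_lt_zero.mpr hμ)]
  simp [div_eq_mul_inv]

/-- For exponential inter-arrival times with rate `μ` (Poisson arrivals):
(i) the always-active policy has expected cost `c_p / μ`;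
(ii) if `c_p ≤ c_cs * μ`, every measurable policy costs at least `c_p / μ`,
with equality for `S = [0,∞)`;
(iii) if `c_p > c_cs * μ`, every measurable policy costs at least `c_cs`,
with equality for `S = ∅`. -/
theorem poisson_optimal_policy
    (c_p c_cs μ : ℝ) (hcp : 0 < c_p) (hccs : 0 < c_cs) (hμ : 0 < μ)
    (f F g : ℝ → ℝ)
    (hf : ∀ x, 0 ≤ x → f x = μ * Real.exp (-μ * x))
    (hF : ∀ x, 0 ≤ x → F x = 1 - Real.exp (-μ * x))
    (hg : ∀ x, 0 ≤ x → g x = c_p * Real.exp (-μ * x) - c_cs * μ * Real.exp (-μ * x)) :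
    (c_cs + ∫ x in Set.Ioi (0 : ℝ), g x = c_p / μ) ∧
    (c_p ≤ c_cs * μ →
      (∀ S : Set ℝ, MeasurableSet S → S ⊆ Set.Ici 0 →
        c_p / μ ≤ c_cs + ∫ x in S, g x) ∧
      c_cs + ∫ x in Set.Ici (0 : ℝ), g x = c_p / μ) ∧
    (c_cs * μ < c_p →
      (∀ S : Set ℝ, MeasurableSet S → S ⊆ Set.Ici 0 →
        c_cs ≤ c_cs + ∫ x in S, g x) ∧
      c_cs + ∫ x in (∅ : Set ℝ), g x = c_cs) := by
  have hg' : ∀ x, 0 ≤ x → g x = (c_p - c_cs * μ) * Real.exp (-μ * x) := fun x hx => by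
    rw [hg x hx, sub_mul]
  have hcost : c_cs + ∫ x in Ici (0 : ℝ), g x = c_p / μ := by
    rw [integral_Ici_of_eq_mul_exp hμ hg']
    field_simp
    ring
  refine ⟨by rwa [← integral_Ici_eq_integral_Ioi], fun h => ⟨fun S _ hS => ?_, hcost⟩,
    fun h => ⟨fun S hSm hS => ?_, by simp⟩⟩
  · have hnonneg : ∀ x ∈ Ici (0 : ℝ), 0 ≤ -g x := fun x hx => by
      rw [hg' x hx, ← neg_mul]
      exact mul_nonneg (by linarith) (Real.exp_pos _).le
    have hmono : ∫ x in S, -g x ≤ ∫ x in Ici (0 : ℝ), -g x :=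
      setIntegral_mono_set (integrableOn_Ici_of_eq_mul_exp hμ hg').neg
        (ae_restrict_of_forall_mem measurableSet_Ici hnonneg) hS.eventuallyLE
    rw [integral_neg, integral_neg] at hmono
    linarith
  · refine le_add_of_nonneg_right (setIntegral_nonneg hSm fun x hx => ?_)
    rw [hg' x (hS hx)]
    exact mul_nonneg (by linarith) (Real.exp_pos _).le
end

section
/- Let c_p > 0, c_cs > 0, τ_∅ ≥ 0 and τ > 0. Then for every x ≥ 0 and every τ' ≥ τ_∅, cost(x, τ) ≤ max{ 1 + c_p·τ/(c_p·τ_∅ + c_cs), 1 + c_cs/(c_p·τ) } · cost(x, τ'); that is, the history-independent policy with keep-alive window τ is a max{ 1 + c_p·τ/(c_p·τ_∅ + c_cs), 1 + c_cs/(c_p·τ) }-approximation of any benchmark single-window policy whose window is at least τ_∅. -/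
/-- A history-independent single-window policy with keep-alive window `τ > 0` is
a `max (1 + c_p τ / (c_p τ_∅ + c_cs)) (1 + c_cs / (c_p τ))`-approximation of any
benchmark single-window policy whose window is at least `τ_∅`. -/
theorem history_independent_approximation
    (c_p c_cs τ_emp τ : ℝ) (hcp : 0 < c_p) (hccs : 0 < c_cs)
    (hτ_emp : 0 ≤ τ_emp) (hτ : 0 < τ)
    (cost : ℝ → ℝ → ℝ)
    (hcost : ∀ x t, cost x t = if x ≤ t then c_p * x else c_p * t + c_cs) :
    ∀ x, 0 ≤ x → ∀ τ', τ_emp ≤ τ' →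
      cost x τ ≤
        max (1 + c_p * τ / (c_p * τ_emp + c_cs)) (1 + c_cs / (c_p * τ)) *
          cost x τ' := by
  intro x hx τ' hτ'
  have hD : 0 < c_p * τ_emp + c_cs := by positivity
  have hpτ : 0 < c_p * τ := mul_pos hcp hτ
  have hτ'0 : 0 ≤ c_p * τ' := mul_nonneg hcp.le (hτ_emp.trans hτ')
  have hcost_nonneg : 0 ≤ cost x τ' := by
    rw [hcost]
    split_ifs <;> positivity
  have miss : c_p * τ + c_cs ≤
      (1 + c_p * τ / (c_p * τ_emp + c_cs)) * (c_p * τ' + c_cs) := by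
    have h : c_p * τ ≤ c_p * τ / (c_p * τ_emp + c_cs) * (c_p * τ' + c_cs) := by
      rw [div_mul_eq_mul_div, le_div_iff₀ hD]
      gcongr
    linarith
  by_cases h₁ : x ≤ τ <;> by_cases h₂ : x ≤ τ'
  · have hone : 1 ≤ max (1 + c_p * τ / (c_p * τ_emp + c_cs)) (1 + c_cs / (c_p * τ)) :=
      le_max_of_le_left (le_add_of_nonneg_right (by positivity))
    have heq : cost x τ = cost x τ' := by simp only [hcost, if_pos h₁, if_pos h₂]
    rw [heq]
    exact le_mul_of_one_le_left hcost_nonneg hone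
  · refine le_trans ?_ (mul_le_mul_of_nonneg_right (le_max_left _ _) hcost_nonneg)
    rw [hcost, hcost, if_pos h₁, if_neg h₂]
    have := mul_le_mul_of_nonneg_left h₁ hcp.le
    linarith
  · refine le_trans ?_ (mul_le_mul_of_nonneg_right (le_max_right _ _) hcost_nonneg)
    rw [hcost, hcost, if_neg h₁, if_pos h₂]
    have hle : τ ≤ x := (not_le.mp h₁).le
    calc c_p * τ + c_cs = (1 + c_cs / (c_p * τ)) * (c_p * τ) := by field_simp
      _ ≤ (1 + c_cs / (c_p * τ)) * (c_p * x) := by gcongr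
  · refine le_trans ?_ (mul_le_mul_of_nonneg_right (le_max_left _ _) hcost_nonneg)
    rw [hcost, hcost, if_neg h₁, if_neg h₂]
    exact miss
end

section
/- Let c_p > 0 and c_cs > 0 and set τ_fixed = c_cs/c_p. Then for every x ≥ 0 and every τ' ≥ 0, cost(x, τ_fixed) ≤ 2 · cost(x, τ'); that is, the fixed keep-alive policy with window c_cs/c_p is a worst-case 2-approximation of every single-window keep-alive policy, and in particular of the optimal history-dependent policy. -/
/-- Ski-rental style guarantee: the fixed keep-alive policy with window
`c_cs / c_p` is a worst-case 2-approximation of every single-window keep-alive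
policy. -/
theorem fixed_policy_two_approximation
    (c_p c_cs : ℝ) (hcp : 0 < c_p) (hccs : 0 < c_cs)
    (τ_fixed : ℝ) (hτ_fixed : τ_fixed = c_cs / c_p)
    (cost : ℝ → ℝ → ℝ)
    (hcost : ∀ x t, cost x t = if x ≤ t then c_p * x else c_p * t + c_cs) :
    ∀ x, 0 ≤ x → ∀ τ', 0 ≤ τ' →
      cost x τ_fixed ≤ 2 * cost x τ' := by
  intro x hx τ' hτ'
  have hτ : c_p * τ_fixed = c_cs := by
    rw [hτ_fixed, mul_div_cancel₀ _ hcp.ne']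
  have hpx : 0 ≤ c_p * x := mul_nonneg hcp.le hx
  have hpτ' : 0 ≤ c_p * τ' := mul_nonneg hcp.le hτ'
  rw [hcost x τ_fixed, hcost x τ']
  by_cases h : x ≤ τ_fixed
  · have := mul_le_mul_of_nonneg_left h hcp.le
    rw [if_pos h]
    split_ifs <;> linarith
  · have := mul_le_mul_of_nonneg_left (not_le.mp h).le hcp.le
    rw [if_neg h]
    split_ifs <;> linarith
end

section
/- Let c_p > 0, c_cs > 0, τ_∅ ≥ 0 and set τ_approx = sqrt( (c_cs/c_p)·( τ_∅ + c_cs/c_p ) ). Then for every x ≥ 0 and every τ' ≥ τ_∅, cost(x, τ_approx) ≤ ( 1 + sqrt( 1/( (c_p/c_cs)·τ_∅ + 1 ) ) ) · cost(x, τ'), and this approximation factor satisfies 1 + sqrt( 1/( (c_p/c_cs)·τ_∅ + 1 ) ) ≤ 2. -/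
/-- The approximate history-independent policy with window
`sqrt((c_cs/c_p) * (τ_∅ + c_cs/c_p))` achieves approximation factor
`1 + sqrt(1 / ((c_p/c_cs) * τ_∅ + 1))` against any benchmark single-window
policy whose window is at least `τ_∅`; this factor is at most 2. -/
theorem approx_policy_approximation
    (c_p c_cs τ_emp : ℝ) (hcp : 0 < c_p) (hccs : 0 < c_cs) (hτ_emp : 0 ≤ τ_emp)
    (τ_approx : ℝ)
    (hτ_approx : τ_approx = Real.sqrt ((c_cs / c_p) * (τ_emp + c_cs / c_p)))
    (cost : ℝ → ℝ → ℝ)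
    (hcost : ∀ x t, cost x t = if x ≤ t then c_p * x else c_p * t + c_cs) :
    (∀ x, 0 ≤ x → ∀ τ', τ_emp ≤ τ' →
      cost x τ_approx ≤
        (1 + Real.sqrt (1 / ((c_p / c_cs) * τ_emp + 1))) * cost x τ') ∧
    1 + Real.sqrt (1 / ((c_p / c_cs) * τ_emp + 1)) ≤ 2 := by
  obtain ⟨a, ha⟩ : ∃ a, a = c_cs / c_p := ⟨_, rfl⟩
  have ha0 : 0 < a := ha ▸ div_pos hccs hcp
  have hc : c_cs = c_p * a := by rw [ha]; field_simp
  have hTa : 0 < τ_emp + a := by linarith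
  have hs : 1 / ((c_p / c_cs) * τ_emp + 1) = a / (τ_emp + a) := by
    rw [hc]; field_simp
  rw [← ha] at hτ_approx
  rw [hs]
  obtain ⟨s, hsdef⟩ : ∃ s, s = Real.sqrt (a / (τ_emp + a)) := ⟨_, rfl⟩
  rw [← hsdef]
  have hs0 : 0 ≤ s := hsdef ▸ Real.sqrt_nonneg _
  have hs1 : s ≤ 1 := by
    rw [hsdef, Real.sqrt_le_iff, one_pow, div_le_one hTa]
    exact ⟨zero_le_one, by linarith⟩
  have hsq : s * s * (τ_emp + a) = a := by
    rw [hsdef, Real.mul_self_sqrt (by positivity)]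
    field_simp
  have hA : τ_approx = s * (τ_emp + a) := by
    rw [hτ_approx, Real.sqrt_eq_iff_mul_self_eq (by positivity) (by positivity)]
    linear_combination (-(τ_emp + a)) * hsq
  have hsA : s * τ_approx = a := by rw [hA]; linarith
  refine ⟨fun x hx τ' hτ' => ?_, by linarith⟩
  have hopt : τ_approx + a + τ_emp ≤ (1 + s) * (τ' + a) := by
    rw [hA]; nlinarith
  rw [hcost, hcost, hc]
  split_ifs with h₁ h₂ h₂
  · nlinarith [mul_nonneg hs0 (mul_nonneg hcp.le hx)]
  · have : x ≤ (1 + s) * (τ' + a) := by linarith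
    nlinarith [mul_le_mul_of_nonneg_left this hcp.le]
  · have : τ_approx + a ≤ (1 + s) * x := by nlinarith
    nlinarith [mul_le_mul_of_nonneg_left this hcp.le]
  · have : τ_approx + a ≤ (1 + s) * (τ' + a) := by linarith
    nlinarith [mul_le_mul_of_nonneg_left this hcp.le]
end

section
/- Let c_p > 0, c_cs > 0 and τ_∅ ≥ 0. For every τ > 0, max{ 1 + c_p·τ/(c_p·τ_∅ + c_cs), 1 + c_cs/(c_p·τ) } ≥ 1 + sqrt( c_cs/(c_p·τ_∅ + c_cs) ), with equality if and only if τ = sqrt( (c_cs/c_p)·( τ_∅ + c_cs/c_p ) ); that is, the window length sqrt( (c_cs/c_p)·( τ_∅ + c_cs/c_p ) ) minimizes the worst-case approximation-factor bound of the history-independent keep-alive policy. -/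
/-- The geometric mean of two nonnegative reals is at most their maximum. -/
theorem sqrt_mul_le_max {a b : ℝ} (ha : 0 ≤ a) (hb : 0 ≤ b) : √(a * b) ≤ max a b := by
  have h : 0 ≤ max a b := ha.trans (le_max_left a b)
  rw [Real.sqrt_le_left h, sq]
  exact mul_le_mul (le_max_left a b) (le_max_right a b) hb h

/-- The maximum of two positive reals equals their geometric mean iff they are equal. -/
theorem max_eq_sqrt_mul_iff {a b : ℝ} (ha : 0 < a) (hb : 0 < b) :
    max a b = √(a * b) ↔ a = b := by
  rw [eq_comm, Real.sqrt_eq_iff_mul_self_eq (by positivity) (by positivity)]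
  constructor
  · intro h
    rcases le_total a b with hab | hab
    · rw [max_eq_right hab] at h
      exact mul_right_cancel₀ hb.ne' h
    · rw [max_eq_left hab] at h
      exact mul_left_cancel₀ ha.ne' h.symm
  · rintro rfl
    rw [max_self]

/-- The worst-case approximation-factor bound
`max (1 + c_p τ / (c_p τ_∅ + c_cs)) (1 + c_cs / (c_p τ))` of a
history-independent keep-alive policy is at least
`1 + sqrt(c_cs / (c_p τ_∅ + c_cs))`, with equality exactly when
`τ = sqrt((c_cs/c_p) * (τ_∅ + c_cs/c_p))`. -/
theorem approx_window_minimizes_bound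
    (c_p c_cs τ_emp : ℝ) (hcp : 0 < c_p) (hccs : 0 < c_cs) (hτ_emp : 0 ≤ τ_emp) :
    ∀ τ : ℝ, 0 < τ →
      1 + Real.sqrt (c_cs / (c_p * τ_emp + c_cs)) ≤
        max (1 + c_p * τ / (c_p * τ_emp + c_cs)) (1 + c_cs / (c_p * τ)) ∧
      (max (1 + c_p * τ / (c_p * τ_emp + c_cs)) (1 + c_cs / (c_p * τ)) =
          1 + Real.sqrt (c_cs / (c_p * τ_emp + c_cs)) ↔
        τ = Real.sqrt ((c_cs / c_p) * (τ_emp + c_cs / c_p))) := by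
  intro τ hτ
  have hD : 0 < c_p * τ_emp + c_cs := by positivity
  have hprod : c_cs / (c_p * τ_emp + c_cs) =
      c_p * τ / (c_p * τ_emp + c_cs) * (c_cs / (c_p * τ)) := by
    field_simp
  have ha : 0 < c_p * τ / (c_p * τ_emp + c_cs) := by positivity
  have hb : 0 < c_cs / (c_p * τ) := by positivity
  rw [max_add_add_left, add_le_add_iff_left, add_right_inj, hprod]
  refine ⟨sqrt_mul_le_max ha.le hb.le, ?_⟩
  rw [max_eq_sqrt_mul_iff ha hb, eq_comm (a := τ),
    Real.sqrt_eq_iff_mul_self_eq (by positivity) hτ.le, div_eq_div_iff hD.ne' (by positivity)]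
  have hopt : c_cs / c_p * (τ_emp + c_cs / c_p) =
      c_cs * (c_p * τ_emp + c_cs) / (c_p * c_p) := by
    field_simp
  rw [hopt, div_eq_iff (by positivity)]
  constructor <;> intro h <;> linarith
end
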